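/- Let $C \subset \mathbb{R}^n$ ($n \ge 2$) be a pointed closed convex cone with nonempty interior, and let $A_0, A_1$ be $C$-coconvex sets. Then the mixed volume satisfies Minkowski's first inequality in reversed form: $\overline{V}(A_0, \ldots, A_0, A_1)^n \le V_n(A_0)^{n-1} V_n(A_1)$, with equality if and only if $A_0 = \alpha A_1$ for some $\alpha > 0$. -/

import Mathlib

open Set Pointwise MeasureTheory

lemma poly_cmp {n : ℕ} (hn : 1 ≤ n) (a b : ℕ → ℝ) (h0 : a 0 = b 0)
    (h : ∀ l : ℝ, 0 ≤ l → ∑ i ∈ Finset.range (n + 1), (n.choose i : ℝ) * l ^ i * a i ≤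
      ∑ i ∈ Finset.range (n + 1), (n.choose i : ℝ) * l ^ i * b i) : a 1 ≤ b 1 := by
  have key : ∀ l : ℝ, 0 < l →
      0 ≤ ∑ i ∈ Finset.range n, (n.choose (i + 1) : ℝ) * l ^ i * (b (i + 1) - a (i + 1)) := by
    intro l hl
    have h1 := h l hl.le
    rw [Finset.sum_range_succ', Finset.sum_range_succ', h0] at h1
    have h2 : l * ∑ i ∈ Finset.range n, (n.choose (i + 1) : ℝ) * l ^ i * (b (i + 1) - a (i + 1)) =
        ∑ i ∈ Finset.range n, (n.choose (i + 1) : ℝ) * l ^ (i + 1) * b (i + 1) -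
        ∑ i ∈ Finset.range n, (n.choose (i + 1) : ℝ) * l ^ (i + 1) * a (i + 1) := by
      rw [Finset.mul_sum, ← Finset.sum_sub_distrib]
      refine Finset.sum_congr rfl fun i _ => ?_
      ring
    refine nonneg_of_mul_nonneg_right (a := l) ?_ hl
    rw [h2]; linarith
  have hc : Continuous fun l : ℝ =>
      ∑ i ∈ Finset.range n, (n.choose (i + 1) : ℝ) * l ^ i * (b (i + 1) - a (i + 1)) := by
    fun_prop
  have ht := (hc.tendsto 0).mono_left (nhdsWithin_le_nhds (s := Ioi (0 : ℝ)))
  have h3 := ge_of_tendsto ht (by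
    filter_upwards [self_mem_nhdsWithin] with l hl using key l hl)
  obtain ⟨m, rfl⟩ : ∃ m, n = m + 1 := ⟨n - 1, by omega⟩
  rw [Finset.sum_range_succ'] at h3
  simp at h3
  have : (0 : ℝ) < (m : ℝ) + 1 := by positivity
  have := nonneg_of_mul_nonneg_right h3 this
  linarith

lemma amgm_aux (m : ℕ) (x y : ℝ) (hx : 0 ≤ x) (hy : 0 ≤ y) :
    0 ≤ (m + 1) * x ^ (m + 2) + y ^ (m + 2) - (m + 2) * (x ^ (m + 1) * y) ∧
    (x ≠ y → 0 < (m + 1) * x ^ (m + 2) + y ^ (m + 2) - (m + 2) * (x ^ (m + 1) * y)) := by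
  induction m with
  | zero =>
    have e : ((0 : ℕ) + 1 : ℝ) * x ^ (0 + 2) + y ^ (0 + 2) - ((0 : ℕ) + 2) * (x ^ (0 + 1) * y) =
        (x - y) ^ 2 := by push_cast; ring
    rw [e]
    refine ⟨sq_nonneg _, fun h => ?_⟩
    have := sub_ne_zero.2 h
    positivity
  | succ m ih =>
    have e : (((m + 1 : ℕ) : ℝ) + 1) * x ^ (m + 1 + 2) + y ^ (m + 1 + 2) -
        (((m + 1 : ℕ) : ℝ) + 2) * (x ^ (m + 1 + 1) * y) =
        y * ((m + 1) * x ^ (m + 2) + y ^ (m + 2) - (m + 2) * (x ^ (m + 1) * y)) +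
        (m + 2) * x ^ (m + 1) * (x - y) ^ 2 := by push_cast; ring
    rw [e]
    refine ⟨add_nonneg (mul_nonneg hy ih.1) (by positivity), fun h => ?_⟩
    rcases hx.eq_or_lt with h0 | h0
    · have hy' : 0 < y := lt_of_le_of_ne hy (by rw [h0]; exact h)
      exact add_pos_of_pos_of_nonneg (mul_pos hy' (ih.2 h)) (by positivity)
    · have := sub_ne_zero.2 h
      exact add_pos_of_nonneg_of_pos (mul_nonneg hy ih.1) (by positivity)

lemma integrable_mix {X : Type*} [MeasurableSpace X] (σ : Measure X) {n : ℕ}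
    (p q : X → ℝ) (hp : Measurable p) (hq : Measurable q) (hp0 : ∀ x, 0 ≤ p x) (hq0 : ∀ x, 0 ≤ q x)
    (hpi : Integrable (fun x => p x ^ n) σ) (hqi : Integrable (fun x => q x ^ n) σ)
    (i : ℕ) (hi : i ≤ n) : Integrable (fun x => p x ^ (n - i) * q x ^ i) σ := by
  refine (hpi.add hqi).mono' (by fun_prop) (Filter.Eventually.of_forall fun x => ?_)
  have h1 := hp0 x
  have h2 := hq0 x
  rw [Real.norm_of_nonneg (by positivity)]
  simp only [Pi.add_apply]
  rcases le_total (p x) (q x) with h | h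
  · calc p x ^ (n - i) * q x ^ i ≤ q x ^ (n - i) * q x ^ i := by gcongr
      _ = q x ^ n := by rw [← pow_add]; congr 1; omega
      _ ≤ _ := by linarith [pow_nonneg h1 n]
  · calc p x ^ (n - i) * q x ^ i ≤ p x ^ (n - i) * p x ^ i := by gcongr
      _ = p x ^ n := by rw [← pow_add]; congr 1; omega
      _ ≤ _ := by linarith [pow_nonneg h2 n]

lemma holder_eq {X : Type*} [MeasurableSpace X] (σ : Measure X) {n : ℕ} (hn : 2 ≤ n)
    (p q : X → ℝ) (hp : Measurable p) (hq : Measurable q) (hp0 : ∀ x, 0 ≤ p x) (hq0 : ∀ x, 0 ≤ q x)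
    (hpi : Integrable (fun x => p x ^ n) σ) (hqi : Integrable (fun x => q x ^ n) σ)
    (hP : 0 < ∫ x, p x ^ n ∂σ) (hQ : 0 < ∫ x, q x ^ n ∂σ) :
    (∫ x, p x ^ (n - 1) * q x ^ 1 ∂σ) ^ n ≤ (∫ x, p x ^ n ∂σ) ^ (n - 1) * ∫ x, q x ^ n ∂σ ∧
    ((∫ x, p x ^ (n - 1) * q x ^ 1 ∂σ) ^ n = (∫ x, p x ^ n ∂σ) ^ (n - 1) * ∫ x, q x ^ n ∂σ →
      ∃ c : ℝ, 0 < c ∧ ∀ᵐ x ∂σ, p x = c * q x) := by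
  have hmix := integrable_mix σ p q hp hq hp0 hq0 hpi hqi 1 (by omega)
  obtain ⟨m, rfl⟩ : ∃ m, n = m + 2 := ⟨n - 2, by omega⟩
  set P := ∫ x, p x ^ (m + 2) ∂σ with hPdef
  set Q := ∫ x, q x ^ (m + 2) ∂σ with hQdef
  have e1 : m + 2 - 1 = m + 1 := by omega
  rw [e1] at hmix ⊢
  simp only [pow_one] at hmix ⊢
  set I := ∫ x, p x ^ (m + 1) * q x ∂σ with hI
  obtain ⟨a, ha, haP⟩ : ∃ a : ℝ, 0 < a ∧ a ^ (m + 2) = P :=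
    ⟨P ^ ((((m + 2 : ℕ) : ℝ))⁻¹), by positivity, Real.rpow_inv_natCast_pow hP.le (by omega)⟩
  obtain ⟨b, hb, hbQ⟩ : ∃ b : ℝ, 0 < b ∧ b ^ (m + 2) = Q :=
    ⟨Q ^ ((((m + 2 : ℕ) : ℝ))⁻¹), by positivity, Real.rpow_inv_natCast_pow hQ.le (by omega)⟩
  have hI0 : 0 ≤ I := integral_nonneg fun x => mul_nonneg (pow_nonneg (hp0 x) _) (hq0 x)
  -- the defect function
  let D : X → ℝ := fun x => (m + 1) * (p x / a) ^ (m + 2) + (q x / b) ^ (m + 2)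
    - (m + 2) * ((p x / a) ^ (m + 1) * (q x / b))
  have hD0 : ∀ x, 0 ≤ D x := fun x =>
    (amgm_aux m _ _ (div_nonneg (hp0 x) ha.le) (div_nonneg (hq0 x) hb.le)).1
  have hDeq : D = fun x => ((m + 1) / P) * p x ^ (m + 2) + (1 / Q) * q x ^ (m + 2)
    - ((m + 2) / (a ^ (m + 1) * b)) * (p x ^ (m + 1) * q x) := by
    funext x
    simp only [D, div_pow, haP, hbQ]
    field_simp
  have hDi : Integrable D σ := by
    rw [hDeq]
    exact ((hpi.const_mul _).add (hqi.const_mul _)).sub (hmix.const_mul _)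
  have hDint : ∫ x, D x ∂σ = (m + 2) - ((m + 2) / (a ^ (m + 1) * b)) * I := by
    have hs := (hpi.const_mul (((m : ℝ) + 1) / P)).add (hqi.const_mul (1 / Q))
    simp only [hDeq]
    rw [integral_sub (by exact hs) (hmix.const_mul _),
      integral_add (hpi.const_mul _) (hqi.const_mul _), integral_const_mul, integral_const_mul,
      integral_const_mul, ← hPdef, ← hQdef]
    field_simp
    ring
  have hle : I ≤ a ^ (m + 1) * b := by
    have := integral_nonneg (μ := σ) (f := D) (fun x => hD0 x)
    rw [hDint] at this
    have h2 : (m + 2 : ℝ) / (a ^ (m + 1) * b) * I = (m + 2) * (I / (a ^ (m + 1) * b)) := by ring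
    rw [h2] at this
    have h3 : I / (a ^ (m + 1) * b) ≤ 1 := by
      by_contra! h
      have : (0 : ℝ) < m + 2 := by positivity
      nlinarith
    rwa [div_le_one (by positivity)] at h3
  have hRHS : P ^ (m + 1) * Q = (a ^ (m + 1) * b) ^ (m + 2) := by
    rw [← haP, ← hbQ]; ring
  rw [hRHS]
  refine ⟨pow_le_pow_left₀ hI0 hle _, fun h => ⟨a / b, by positivity, ?_⟩⟩
  have hIe : I = a ^ (m + 1) * b :=
    (pow_left_inj₀ hI0 (by positivity) (by omega)).1 h
  rw [hIe, div_mul_cancel₀ _ (by positivity), sub_self] at hDint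
  have hae := (integral_eq_zero_iff_of_nonneg hD0 hDi).1 hDint
  filter_upwards [hae] with x hx
  by_contra hne
  have : p x / a ≠ q x / b := by
    intro h; apply hne; field_simp at h ⊢; linarith
  have := (amgm_aux m _ _ (div_nonneg (hp0 x) ha.le) (div_nonneg (hq0 x) hb.le)).2 this
  exact absurd hx this.ne'

noncomputable def nuR (n : ℕ) : Measure (Ioi (0 : ℝ)) := Measure.volumeIoiPow (n - 1)

noncomputable def sigS (n : ℕ) : Measure (Metric.sphere (0 : EuclideanSpace ℝ (Fin n)) 1) :=
  (volume : Measure (EuclideanSpace ℝ (Fin n))).toSphere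

instance (n : ℕ) : SigmaFinite (nuR n) := by unfold nuR; infer_instance
instance (n : ℕ) : IsFiniteMeasure (sigS n) := by unfold sigS; infer_instance

lemma polar0 {n : ℕ} (hn : 0 < n) (S : Set (EuclideanSpace ℝ (Fin n))) :
    volume S = ((sigS n).prod (nuR n)) {p | p.2.1 • p.1.1 ∈ S} := by
  have : Nonempty (Fin n) := ⟨⟨0, hn⟩⟩
  have h := (volume : Measure (EuclideanSpace ℝ (Fin n))).measurePreserving_homeomorphUnitSphereProd
  rw [finrank_euclideanSpace_fin] at h
  change _ = ((volume : Measure (EuclideanSpace ℝ (Fin n))).toSphere.prod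
    (Measure.volumeIoiPow (n - 1))) _
  rw [← h.measure_preimage_emb (Homeomorph.measurableEmbedding _),
    comap_subtype_coe_apply (measurableSet_singleton _).compl]
  have : volume S = volume (S \ {0}) := (measure_sdiff_null (measure_singleton _)).symm
  rw [this]
  congr 1
  ext x
  simp only [mem_sdiff, mem_singleton_iff, mem_image, mem_preimage, mem_ofPred_eq, Subtype.exists,
    mem_compl_iff, exists_and_right, exists_eq_right]
  constructor
  · rintro ⟨h1, h2⟩
    refine ⟨h2, ?_⟩
    have : ‖x‖ ≠ 0 := norm_ne_zero_iff.2 h2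
    simp [smul_smul, this, h1]
  · rintro ⟨h1, h2⟩
    refine ⟨?_, h1⟩
    have : ‖x‖ ≠ 0 := norm_ne_zero_iff.2 h1
    simpa [smul_smul, this] using h2

lemma measurable_slice {n : ℕ} {S : Set (EuclideanSpace ℝ (Fin n))} (hS : MeasurableSet S) :
    MeasurableSet {p : Metric.sphere (0 : EuclideanSpace ℝ (Fin n)) 1 × Ioi (0 : ℝ) |
      p.2.1 • p.1.1 ∈ S} := by
  have : Measurable fun p : Metric.sphere (0 : EuclideanSpace ℝ (Fin n)) 1 × Ioi (0 : ℝ) =>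
      p.2.1 • p.1.1 := by
    have : Continuous fun p : Metric.sphere (0 : EuclideanSpace ℝ (Fin n)) 1 × Ioi (0 : ℝ) =>
      p.2.1 • p.1.1 := by fun_prop
    exact this.measurable
  exact this hS

lemma nuR_lt {n : ℕ} (hn : 0 < n) (g : ℝ) (hg : 0 ≤ g) :
    nuR n {r | r.1 < g} = ENNReal.ofReal (g ^ n / n) := by
  rcases hg.eq_or_lt with rfl | h
  · have : {r : Ioi (0 : ℝ) | r.1 < 0} = ∅ := by
      ext r; simpa using (mem_Ioi.1 r.2).le
    rw [this]; simp [hn.ne']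
  · have := Measure.volumeIoiPow_apply_Iio (n - 1) ⟨g, h⟩
    have e : n - 1 + 1 = n := by omega
    have e2 : ((n - 1 : ℕ) : ℝ) + 1 = n := by exact_mod_cast e
    rw [e, e2] at this
    exact this

/-- the slice measure -/
noncomputable def slm {n : ℕ} (A : Set (EuclideanSpace ℝ (Fin n)))
    (u : Metric.sphere (0 : EuclideanSpace ℝ (Fin n)) 1) : ENNReal :=
  nuR n {r | r.1 • u.1 ∈ A}

lemma measurable_slm {n : ℕ} {A : Set (EuclideanSpace ℝ (Fin n))} (hA : MeasurableSet A) :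
    Measurable (slm A) :=
  measurable_measure_prodMk_left (measurable_slice hA)

lemma lintegral_slm {n : ℕ} (hn : 0 < n) {A : Set (EuclideanSpace ℝ (Fin n))}
    (hA : MeasurableSet A) : ∫⁻ u, slm A u ∂(sigS n) = volume A := by
  rw [polar0 hn, Measure.prod_apply (measurable_slice hA)]
  rfl

noncomputable def rho {n : ℕ} (A : Set (EuclideanSpace ℝ (Fin n)))
    (u : Metric.sphere (0 : EuclideanSpace ℝ (Fin n)) 1) : ℝ :=
  (n * (slm A u).toReal) ^ ((n : ℝ)⁻¹)

lemma rho_nonneg {n : ℕ} (A : Set (EuclideanSpace ℝ (Fin n))) (u) : 0 ≤ rho A u := by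
  unfold rho; positivity

lemma rho_pow {n : ℕ} (hn : 0 < n) (A : Set (EuclideanSpace ℝ (Fin n))) (u) :
    rho A u ^ n = n * (slm A u).toReal :=
  Real.rpow_inv_natCast_pow (by positivity) hn.ne'

lemma measurable_rho {n : ℕ} {A : Set (EuclideanSpace ℝ (Fin n))} (hA : MeasurableSet A) :
    Measurable (rho A) :=
  ((measurable_slm hA).ennreal_toReal.const_mul _).pow_const _

lemma integrable_rho {n : ℕ} (hn : 0 < n) {A : Set (EuclideanSpace ℝ (Fin n))}
    (hA : MeasurableSet A) (hf : volume A < ⊤) :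
    Integrable (fun u => rho A u ^ n) (sigS n) := by
  simp only [rho_pow hn]
  refine (integrable_toReal_of_lintegral_ne_top (measurable_slm hA).aemeasurable ?_).const_mul _
  rw [lintegral_slm hn hA]; exact hf.ne

lemma ae_slm {n : ℕ} (hn : 0 < n) {A : Set (EuclideanSpace ℝ (Fin n))}
    (hA : MeasurableSet A) (hf : volume A < ⊤) : ∀ᵐ u ∂(sigS n), slm A u < ⊤ := by
  refine ae_lt_top (measurable_slm hA) ?_
  rw [lintegral_slm hn hA]; exact hf.ne

lemma integral_rho {n : ℕ} (hn : 0 < n) {A : Set (EuclideanSpace ℝ (Fin n))}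
    (hA : MeasurableSet A) (hf : volume A < ⊤) :
    ∫ u, rho A u ^ n ∂(sigS n) = n * (volume A).toReal := by
  simp only [rho_pow hn]
  rw [integral_const_mul, integral_toReal (measurable_slm hA).aemeasurable (ae_slm hn hA hf),
    lintegral_slm hn hA]

lemma nuR_univ {n : ℕ} (hn : 0 < n) : nuR n univ = ⊤ := by
  refine ENNReal.eq_top_of_forall_nnreal_le fun r => ?_
  have h1 : nuR n {s | s.1 < max 1 (n * r)} ≤ nuR n univ := measure_mono (subset_univ _)
  rw [nuR_lt hn _ (by positivity)] at h1
  refine le_trans ?_ h1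
  rw [← ENNReal.ofReal_coe_nnreal]
  apply ENNReal.ofReal_le_ofReal
  rw [le_div_iff₀ (by exact_mod_cast hn)]
  calc (r : ℝ) * n ≤ max 1 (n * (r : ℝ)) := by rw [mul_comm]; exact le_max_right _ _
    _ ≤ _ := le_self_pow₀ (le_max_left _ _) hn.ne'

lemma rho_spec {n : ℕ} (hn : 0 < n) {C K : Set (EuclideanSpace ℝ (Fin n))}
    (hC_cone : ∀ x ∈ C, ∀ r : ℝ, 0 ≤ r → r • x ∈ C)
    (hKclosed : IsClosed K) (hrec : ∀ x ∈ K, ∀ y ∈ C, x + y ∈ K)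
    (u) (hu : u.1 ∈ C) (hfin : slm (C \ K) u < ⊤) (r : ℝ) (hr : 0 ≤ r) :
    r • u.1 ∈ K ↔ rho (C \ K) u ≤ r := by
  let S : Set ℝ := {r | 0 ≤ r ∧ r • u.1 ∈ K}
  have hScl : IsClosed S :=
    isClosed_Ici.inter (hKclosed.preimage (by fun_prop : Continuous fun r : ℝ => r • u.1))
  have hSbdd : BddBelow S := ⟨0, fun x hx => hx.1⟩
  have hSne : S.Nonempty := by
    by_contra hne
    rw [not_nonempty_iff_eq_empty] at hne
    have : {r : Ioi (0 : ℝ) | r.1 • u.1 ∈ C \ K} = univ := by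
      ext r
      simp only [mem_ofPred_eq, mem_univ, iff_true]
      refine ⟨hC_cone _ hu _ (le_of_lt r.2), fun h => ?_⟩
      have : r.1 ∈ S := ⟨le_of_lt r.2, h⟩
      rw [hne] at this
      exact this
    unfold slm at hfin
    rw [this, nuR_univ hn] at hfin
    exact lt_irrefl _ hfin
  have hs : sInf S ∈ S := hScl.csInf_mem hSne hSbdd
  set s := sInf S with hsdef
  have hmem : ∀ r, 0 ≤ r → (r • u.1 ∈ K ↔ s ≤ r) := by
    intro r hr
    refine ⟨fun h => csInf_le hSbdd ⟨hr, h⟩, fun h => ?_⟩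
    have := hrec _ hs.2 _ (hC_cone _ hu (r - s) (by linarith))
    rwa [← add_smul, add_sub_cancel] at this
  have hset : {r : Ioi (0 : ℝ) | r.1 • u.1 ∈ C \ K} = {r | r.1 < s} := by
    ext r
    simp only [mem_ofPred_eq, mem_sdiff]
    rw [hmem _ (le_of_lt r.2), not_le]
    exact ⟨fun h => h.2, fun h => ⟨hC_cone _ hu _ (le_of_lt r.2), h⟩⟩
  have hrho : rho (C \ K) u = s := by
    have h1 := rho_pow hn (C \ K) u
    unfold slm at h1
    rw [hset, nuR_lt hn _ hs.1, ENNReal.toReal_ofReal (by have := hs.1; positivity),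
      mul_div_cancel₀ _ (by exact_mod_cast hn.ne')] at h1
    exact (pow_left_inj₀ (rho_nonneg _ _) hs.1 hn.ne').1 h1
  rw [hrho]; exact hmem r hr

lemma vol_top {n : ℕ} (hn : 0 < n) {A D : Set (EuclideanSpace ℝ (Fin n))} (hD : IsOpen D)
    (hDne : D.Nonempty) (x : EuclideanSpace ℝ (Fin n))
    (h : ∀ T : ℝ, 1 ≤ T → ∀ z ∈ D, x + T • z ∈ A) : volume A = ⊤ := by
  by_contra hA
  obtain ⟨N, hN⟩ := ENNReal.exists_nat_mul_gt (hD.measure_pos volume hDne).ne' hA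
  have hsub : x +ᵥ (((N : ℝ) + 1) • D) ⊆ A := by
    rintro _ ⟨_, ⟨z, hz, rfl⟩, rfl⟩
    exact h _ (by linarith [(Nat.cast_nonneg N : (0 : ℝ) ≤ N)]) z hz
  have h1 := measure_mono (μ := volume) hsub
  rw [measure_vadd, Measure.addHaar_smul, finrank_euclideanSpace_fin] at h1
  refine absurd (hN.trans_le ?_) (not_lt.2 h1)
  gcongr
  rw [← ENNReal.ofReal_natCast]
  apply ENNReal.ofReal_le_ofReal
  refine le_trans ?_ (le_abs_self _)
  have := le_self_pow₀ (by linarith [(Nat.cast_nonneg N : (0 : ℝ) ≤ N)] : (1 : ℝ) ≤ N + 1) hn.ne'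
  linarith

lemma cone_add {n : ℕ} {C : Set (EuclideanSpace ℝ (Fin n))} (hC_conv : Convex ℝ C)
    (hC_cone : ∀ x ∈ C, ∀ r : ℝ, 0 ≤ r → r • x ∈ C) {x y} (hx : x ∈ C) (hy : y ∈ C) :
    x + y ∈ C := by
  have := hC_cone _ (hC_conv hx hy (by norm_num : (0 : ℝ) ≤ 1 / 2) (by norm_num : (0 : ℝ) ≤ 1 / 2)
    (by norm_num)) 2 (by norm_num)
  rw [smul_add, smul_smul, smul_smul] at this
  norm_num at this
  exact this

lemma K_nonempty {n : ℕ} (hn : 0 < n) {C K : Set (EuclideanSpace ℝ (Fin n))}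
    (hC_cone : ∀ x ∈ C, ∀ r : ℝ, 0 ≤ r → r • x ∈ C)
    (hC_int : (interior C).Nonempty) (hf : volume (C \ K) < ⊤) : K.Nonempty := by
  by_contra h
  rw [not_nonempty_iff_eq_empty] at h
  subst h
  refine hf.ne (vol_top hn isOpen_interior hC_int 0 fun T hT z hz => ?_)
  simpa using hC_cone z (interior_subset hz) T (by linarith)

lemma K_rec {n : ℕ} (hn : 0 < n) {C K : Set (EuclideanSpace ℝ (Fin n))}
    (hC_conv : Convex ℝ C) (hC_cone : ∀ x ∈ C, ∀ r : ℝ, 0 ≤ r → r • x ∈ C)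
    (hC_int : (interior C).Nonempty) (hKC : K ⊆ C) (hKclosed : IsClosed K) (hKconv : Convex ℝ K)
    (hf : volume (C \ K) < ⊤) : ∀ x ∈ K, ∀ y ∈ C, x + y ∈ K := by
  intro x hx y hy
  by_contra hxy
  let U : Set (EuclideanSpace ℝ (Fin n)) := {z | x + z ∈ Kᶜ}
  have hU : IsOpen U := hKclosed.isOpen_compl.preimage (by fun_prop)
  have hycl : y ∈ closure (interior C) := by
    rw [hC_conv.closure_interior_eq_closure_of_nonempty_interior hC_int]
    exact subset_closure hy
  have hne : (U ∩ interior C).Nonempty := mem_closure_iff.1 hycl U hU hxy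
  refine hf.ne (vol_top hn (hU.inter isOpen_interior) hne x fun T hT z hz => ⟨?_, fun h => ?_⟩)
  · exact cone_add hC_conv hC_cone (hKC hx) (hC_cone z (interior_subset hz.2) T (by linarith))
  · apply hz.1
    have hT0 : 0 < T := by linarith
    have := hKconv hx h (a := 1 - T⁻¹) (b := T⁻¹) (sub_nonneg.2 (inv_le_one_of_one_le₀ hT))
      (by positivity) (by ring)
    convert this using 1
    rw [smul_add, smul_smul, inv_mul_cancel₀ hT0.ne', sub_smul, one_smul, one_smul]
    abel

lemma sub_of_null {n : ℕ} {K L : Set (EuclideanSpace ℝ (Fin n))} (hKconv : Convex ℝ K)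
    (hKint : (interior K).Nonempty) (hL : IsClosed L) (h : volume (K \ L) = 0) : K ⊆ L := by
  have h1 : interior K \ L = ∅ := by
    have ho : IsOpen (interior K \ L) := isOpen_interior.sdiff hL
    rw [← ho.measure_eq_zero_iff volume]
    exact measure_mono_null (sdiff_subset_sdiff_left interior_subset) h
  rw [sdiff_eq_empty] at h1
  calc K ⊆ closure K := subset_closure
    _ = closure (interior K) :=
      (hKconv.closure_interior_eq_closure_of_nonempty_interior hKint).symm
    _ ⊆ L := hL.closure_subset_iff.2 h1
  
lemma K_int {n : ℕ} {C K : Set (EuclideanSpace ℝ (Fin n))}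
    (hC_int : (interior C).Nonempty) (hKne : K.Nonempty)
    (hrec : ∀ x ∈ K, ∀ y ∈ C, x + y ∈ K) : (interior K).Nonempty := by
  obtain ⟨x, hx⟩ := hKne
  have hsub : x +ᵥ interior C ⊆ K := by
    rintro _ ⟨z, hz, rfl⟩
    exact hrec x hx z (interior_subset hz)
  have ho : IsOpen (x +ᵥ interior C) := isOpen_interior.vadd x
  exact (hC_int.vadd_set (a := x)).mono (interior_maximal hsub ho)

/-- Upper bound for the volume of the co-sum. -/
lemma cosum_le {n : ℕ} (hn : 0 < n) {C K₀ K₁ : Set (EuclideanSpace ℝ (Fin n))}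
    (hC_closed : IsClosed C)
    (hC_cone : ∀ x ∈ C, ∀ r : ℝ, 0 ≤ r → r • x ∈ C)
    (hK₀closed : IsClosed K₀) (hrec₀ : ∀ x ∈ K₀, ∀ y ∈ C, x + y ∈ K₀)
    (hK₁closed : IsClosed K₁) (hrec₁ : ∀ x ∈ K₁, ∀ y ∈ C, x + y ∈ K₁)
    (hA₀fin : volume (C \ K₀) < ⊤) (hA₁fin : volume (C \ K₁) < ⊤) (l : ℝ) (hl : 0 ≤ l) :
    volume (C \ (K₀ + l • K₁)) ≤ ENNReal.ofReal (∑ i ∈ Finset.range (n + 1),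
      (n.choose i : ℝ) * l ^ i *
        ((∫ u, rho (C \ K₀) u ^ (n - i) * rho (C \ K₁) u ^ i ∂(sigS n)) / n)) := by
  have hm₀ : MeasurableSet (C \ K₀) := hC_closed.measurableSet.diff hK₀closed.measurableSet
  have hm₁ : MeasurableSet (C \ K₁) := hC_closed.measurableSet.diff hK₁closed.measurableSet
  set p := rho (C \ K₀) with hp
  set q := rho (C \ K₁) with hq
  have hpm : Measurable p := measurable_rho hm₀
  have hqm : Measurable q := measurable_rho hm₁
  have hp0 : ∀ u, 0 ≤ p u := rho_nonneg _
  have hq0 : ∀ u, 0 ≤ q u := rho_nonneg _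
  have hmix := integrable_mix (sigS n) p q hpm hqm hp0 hq0 (integrable_rho hn hm₀ hA₀fin)
    (integrable_rho hn hm₁ hA₁fin)
  have hg : Measurable fun u => p u + l * q u := hpm.add (hqm.const_mul l)
  have hT : MeasurableSet {x : Metric.sphere (0 : EuclideanSpace ℝ (Fin n)) 1 × Ioi (0 : ℝ) |
      x.2.1 < p x.1 + l * q x.1} :=
    measurableSet_lt (measurable_subtype_coe.comp measurable_snd) (hg.comp measurable_fst)
  have hae : ∀ᵐ x ∂((sigS n).prod (nuR n)), slm (C \ K₀) x.1 < ⊤ ∧ slm (C \ K₁) x.1 < ⊤ :=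
    Measure.quasiMeasurePreserving_fst.ae
      ((ae_slm hn hm₀ hA₀fin).and (ae_slm hn hm₁ hA₁fin))
  have hexp : ∀ u, (p u + l * q u) ^ n / n = ∑ i ∈ Finset.range (n + 1),
      (n.choose i : ℝ) * l ^ i / n * (p u ^ (n - i) * q u ^ i) := by
    intro u
    rw [add_comm (p u), add_pow, Finset.sum_div]
    refine Finset.sum_congr rfl fun i _ => ?_
    rw [mul_pow]; ring
  have hint : ∀ i ∈ Finset.range (n + 1), Integrable (fun u =>
      (n.choose i : ℝ) * l ^ i / n * (p u ^ (n - i) * q u ^ i)) (sigS n) := fun i hi =>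
    (hmix i (by have := Finset.mem_range.1 hi; omega)).const_mul _
  calc volume (C \ (K₀ + l • K₁))
      = ((sigS n).prod (nuR n)) {x | x.2.1 • x.1.1 ∈ C \ (K₀ + l • K₁)} := polar0 hn _
    _ ≤ ((sigS n).prod (nuR n)) {x | x.2.1 < p x.1 + l * q x.1} := by
        apply measure_mono_ae
        filter_upwards [hae] with x hx hxm
        change x.2.1 < p x.1 + l * q x.1
        have hxm : x.2.1 • x.1.1 ∈ C \ (K₀ + l • K₁) := hxm
        have hr : 0 < x.2.1 := x.2.2
        by_contra! hlt
        have huC : x.1.1 ∈ C := by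
          have := hC_cone _ hxm.1 x.2.1⁻¹ (by positivity)
          rwa [smul_smul, inv_mul_cancel₀ hr.ne', one_smul] at this
        apply hxm.2
        have hle : p x.1 ≤ x.2.1 - l * q x.1 := by linarith
        have h0 := (rho_spec hn hC_cone hK₀closed hrec₀ x.1 huC hx.1 (x.2.1 - l * q x.1)
          ((hp0 _).trans hle)).2 hle
        have h1 := (rho_spec hn hC_cone hK₁closed hrec₁ x.1 huC hx.2 (q x.1) (hq0 _)).2 le_rfl
        refine mem_add.2 ⟨_, h0, _, smul_mem_smul_set h1, ?_⟩
        rw [smul_smul, ← add_smul, sub_add_cancel]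
    _ = ∫⁻ u, ENNReal.ofReal ((p u + l * q u) ^ n / n) ∂(sigS n) := by
        rw [Measure.prod_apply hT]
        refine lintegral_congr fun u => ?_
        exact nuR_lt hn _ (add_nonneg (hp0 u) (mul_nonneg hl (hq0 u)))
    _ = ENNReal.ofReal (∫ u, (p u + l * q u) ^ n / n ∂(sigS n)) := by
        rw [ofReal_integral_eq_lintegral_ofReal]
        · simp only [hexp]
          exact integrable_finsetSum _ hint
        · exact Filter.Eventually.of_forall fun u => by
            have := hp0 u
            have := hq0 u
            simp only [Pi.zero_apply]
            positivity
    _ = _ := by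
        congr 1
        simp only [hexp]
        rw [integral_finsetSum _ hint]
        refine Finset.sum_congr rfl fun i _ => ?_
        rw [integral_const_mul]; ring

/-- Minkowski's first inequality in reversed form for `C`-coconvex sets:
if `W i` are the coefficients of the polynomial expansion
`V_n(A₀ ⊕ λ A₁) = Σ_{i=0}^{n} (n choose i) λ^i W i`
(so that `W 1 = V̄(A₀,…,A₀,A₁)` is the mixed volume), then
`V̄(A₀,…,A₀,A₁)^n ≤ V_n(A₀)^{n-1} V_n(A₁)`, with equality iff `A₀ = α • A₁`
for some `α > 0`. -/
theorem coconvex_minkowski_first_inequality {n : ℕ} (hn : 2 ≤ n)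
    (C K₀ K₁ : Set (EuclideanSpace ℝ (Fin n)))
    (hC_closed : IsClosed C) (hC_conv : Convex ℝ C)
    (hC_cone : ∀ x ∈ C, ∀ r : ℝ, 0 ≤ r → r • x ∈ C)
    (hC_pointed : C ∩ (-C) = {0})
    (hC_int : (interior C).Nonempty)
    (hK₀C : K₀ ⊆ C) (hK₀closed : IsClosed K₀) (hK₀conv : Convex ℝ K₀)
    (hK₁C : K₁ ⊆ C) (hK₁closed : IsClosed K₁) (hK₁conv : Convex ℝ K₁)
    (hA₀pos : 0 < volume (C \ K₀)) (hA₀fin : volume (C \ K₀) < ⊤)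
    (hA₁pos : 0 < volume (C \ K₁)) (hA₁fin : volume (C \ K₁) < ⊤)
    (W : ℕ → ℝ)
    (hW : ∀ l : ℝ, 0 ≤ l →
      (volume (C \ (K₀ + l • K₁))).toReal =
        ∑ i ∈ Finset.range (n + 1), (n.choose i : ℝ) * l ^ i * W i) :
    (W 1) ^ n ≤ (volume (C \ K₀)).toReal ^ (n - 1) * (volume (C \ K₁)).toReal ∧
    ((W 1) ^ n = (volume (C \ K₀)).toReal ^ (n - 1) * (volume (C \ K₁)).toReal ↔
      ∃ α : ℝ, 0 < α ∧ C \ K₀ = α • (C \ K₁)) := by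
  have hn0 : 0 < n := by omega
  have hnR : (0 : ℝ) < n := by exact_mod_cast hn0
  have hrec₀ := K_rec hn0 hC_conv hC_cone hC_int hK₀C hK₀closed hK₀conv hA₀fin
  have hrec₁ := K_rec hn0 hC_conv hC_cone hC_int hK₁C hK₁closed hK₁conv hA₁fin
  have hne₀ := K_nonempty hn0 hC_cone hC_int hA₀fin
  have hne₁ := K_nonempty hn0 hC_cone hC_int hA₁fin
  have hm₀ : MeasurableSet (C \ K₀) := hC_closed.measurableSet.diff hK₀closed.measurableSet
  have hm₁ : MeasurableSet (C \ K₁) := hC_closed.measurableSet.diff hK₁closed.measurableSet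
  have hcosum := cosum_le hn0 hC_closed hC_cone hK₀closed hrec₀ hK₁closed hrec₁ hA₀fin hA₁fin
  set M : ℕ → ℝ := fun i =>
    (∫ u, rho (C \ K₀) u ^ (n - i) * rho (C \ K₁) u ^ i ∂(sigS n)) / n with hM
  have hI₀ := integral_rho hn0 hm₀ hA₀fin
  have hI₁ := integral_rho hn0 hm₁ hA₁fin
  set V₀ := (volume (C \ K₀)).toReal with hV₀
  set V₁ := (volume (C \ K₁)).toReal with hV₁
  have hV₀pos : 0 < V₀ := ENNReal.toReal_pos hA₀pos.ne' hA₀fin.ne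
  have hV₁pos : 0 < V₁ := ENNReal.toReal_pos hA₁pos.ne' hA₁fin.ne
  have hW0 : W 0 = V₀ := by
    have := hW 0 le_rfl
    rw [zero_smul_set hne₁, add_zero, Finset.sum_range_succ'] at this
    simpa using this.symm
  have hM0 : M 0 = V₀ := by
    simp only [hM, Nat.sub_zero, pow_zero, mul_one]
    rw [hI₀]; field_simp
  have hMnn : ∀ i, 0 ≤ M i := fun i => div_nonneg (integral_nonneg fun u =>
    mul_nonneg (pow_nonneg (rho_nonneg _ _) _) (pow_nonneg (rho_nonneg _ _) _)) hnR.le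
  have hfin : ∀ l : ℝ, 0 ≤ l → volume (C \ (K₀ + l • K₁)) < ⊤ := fun l hl =>
    (hcosum l hl).trans_lt ENNReal.ofReal_lt_top
  have hWM : W 1 ≤ M 1 := by
    refine poly_cmp (n := n) (by omega) W M (hW0.trans hM0.symm) fun l hl => ?_
    rw [← hW l hl]
    refine ENNReal.toReal_le_of_le_ofReal (Finset.sum_nonneg fun i _ => ?_) (hcosum l hl)
    have := hMnn i
    positivity
  have hWnn : 0 ≤ W 1 := by
    refine poly_cmp (n := n) (by omega) (fun i => if i = 0 then V₀ else 0) W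
      (by simp [hW0]) fun l hl => ?_
    rw [← hW l hl, Finset.sum_range_succ']
    simp only [Nat.add_eq_zero_iff, one_ne_zero, and_false, if_false, mul_zero,
      Finset.sum_const_zero, Nat.choose_zero_right, Nat.cast_one, pow_zero, if_true, mul_one,
      one_mul, zero_add]
    refine ENNReal.toReal_mono (hfin l hl).ne (measure_mono (sdiff_subset_sdiff_right ?_))
    rintro _ ⟨x, hx, _, ⟨y, hy, rfl⟩, rfl⟩
    exact hrec₀ x hx _ (hC_cone y (hK₁C hy) l hl)
  have hold := holder_eq (sigS n) hn (rho (C \ K₀)) (rho (C \ K₁)) (measurable_rho hm₀)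
    (measurable_rho hm₁) (rho_nonneg _) (rho_nonneg _) (integrable_rho hn0 hm₀ hA₀fin)
    (integrable_rho hn0 hm₁ hA₁fin) (by rw [hI₀]; positivity) (by rw [hI₁]; positivity)
  have hJ : ∫ u, rho (C \ K₀) u ^ (n - 1) * rho (C \ K₁) u ^ 1 ∂(sigS n) = n * M 1 := by
    simp only [hM]; field_simp
  have hscale : (n * V₀) ^ (n - 1) * (n * V₁) = (n : ℝ) ^ n * (V₀ ^ (n - 1) * V₁) := by
    obtain ⟨m, rfl⟩ : ∃ m, n = m + 1 := ⟨n - 1, by omega⟩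
    simp only [Nat.add_sub_cancel, mul_pow]; ring
  rw [hJ, hI₀, hI₁, hscale, mul_pow] at hold
  have hnn : (0 : ℝ) < (n : ℝ) ^ n := by positivity
  have hMle : M 1 ^ n ≤ V₀ ^ (n - 1) * V₁ := le_of_mul_le_mul_left hold.1 hnn
  have hle : W 1 ^ n ≤ V₀ ^ (n - 1) * V₁ := (pow_le_pow_left₀ hWnn hWM n).trans hMle
  refine ⟨hle, fun heq => ?_, ?_⟩
  · have hMeq : M 1 ^ n = V₀ ^ (n - 1) * V₁ :=
      le_antisymm hMle (heq ▸ pow_le_pow_left₀ hWnn hWM n)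
    obtain ⟨c, hc, hcae⟩ := hold.2 (by rw [hMeq])
    refine ⟨c, hc, ?_⟩
    have hCc : c • C = C := by
      ext x
      rw [mem_smul_set_iff_inv_smul_mem₀ hc.ne']
      refine ⟨fun h => ?_, fun h => hC_cone x h _ (by positivity)⟩
      have := hC_cone _ h c hc.le
      rwa [smul_smul, mul_inv_cancel₀ hc.ne', one_smul] at this
    have hae : ∀ᵐ x ∂((sigS n).prod (nuR n)),
        (x.2.1 • x.1.1 ∈ K₀ ↔ x.2.1 • x.1.1 ∈ c • K₁) := by
      have h3 : ∀ᵐ x ∂((sigS n).prod (nuR n)), slm (C \ K₀) x.1 < ⊤ ∧ slm (C \ K₁) x.1 < ⊤ ∧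
          rho (C \ K₀) x.1 = c * rho (C \ K₁) x.1 :=
        Measure.quasiMeasurePreserving_fst.ae
          ((ae_slm hn0 hm₀ hA₀fin).and ((ae_slm hn0 hm₁ hA₁fin).and hcae))
      filter_upwards [h3] with x hx
      have hr : 0 < x.2.1 := x.2.2
      rw [mem_smul_set_iff_inv_smul_mem₀ hc.ne', smul_smul]
      by_cases huC : x.1.1 ∈ C
      · rw [rho_spec hn0 hC_cone hK₀closed hrec₀ x.1 huC hx.1 _ hr.le,
          rho_spec hn0 hC_cone hK₁closed hrec₁ x.1 huC hx.2.1 _ (by positivity), hx.2.2,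
          inv_mul_eq_div, le_div_iff₀ hc, mul_comm]
      · have key : ∀ t : ℝ, 0 < t → t • x.1.1 ∉ C := by
          intro t ht h
          have := hC_cone _ h t⁻¹ (by positivity)
          rw [smul_smul, inv_mul_cancel₀ ht.ne', one_smul] at this
          exact huC this
        exact ⟨fun h => absurd (hK₀C h) (key _ hr),
          fun h => absurd (hK₁C h) (key _ (by positivity))⟩
    have hK : K₀ = c • K₁ := by
      apply Subset.antisymm
      · refine sub_of_null hK₀conv (K_int hC_int hne₀ hrec₀) (hK₁closed.smul₀ c) ?_
        rw [polar0 hn0]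
        refine measure_eq_zero_iff_ae_notMem.2 ?_
        filter_upwards [hae] with x hx h
        exact h.2 (hx.1 h.1)
      · have hi : (interior (c • K₁)).Nonempty := by
          rw [interior_smul₀ hc.ne']
          exact (K_int hC_int hne₁ hrec₁).smul_set
        refine sub_of_null (hK₁conv.smul c) hi hK₀closed ?_
        rw [polar0 hn0]
        refine measure_eq_zero_iff_ae_notMem.2 ?_
        filter_upwards [hae] with x hx h
        exact h.2 (hx.2 h.1)
    rw [smul_set_sdiff₀ hc.ne', hCc, ← hK]
  · rintro ⟨α, hα, hA⟩
    have hcC : ∀ c : ℝ, 0 < c → c • C = C := by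
      intro c hc
      ext x
      rw [mem_smul_set_iff_inv_smul_mem₀ hc.ne']
      refine ⟨fun h => ?_, fun h => hC_cone x h _ (by positivity)⟩
      have := hC_cone _ h c hc.le
      rwa [smul_smul, mul_inv_cancel₀ hc.ne', one_smul] at this
    have hK : K₀ = α • K₁ := by
      have h1 : α • K₁ ⊆ C := by rw [← hcC α hα]; exact smul_set_mono hK₁C
      rw [smul_set_sdiff₀ hα.ne', hcC α hα] at hA
      rw [← sdiff_sdiff_cancel_left hK₀C, hA, sdiff_sdiff_cancel_left h1]
    have hvol : ∀ c : ℝ, 0 < c → (volume (C \ (c • K₁))).toReal = c ^ n * V₁ := by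
      intro c hc
      have : C \ (c • K₁) = c • (C \ K₁) := by rw [smul_set_sdiff₀ hc.ne', hcC c hc]
      rw [this, Measure.addHaar_smul, finrank_euclideanSpace_fin, ENNReal.toReal_mul,
        ENNReal.toReal_ofReal (abs_nonneg _), abs_of_pos (by positivity)]
    have hV : V₀ = α ^ n * V₁ := by rw [hV₀, hK, hvol α hα]
    have hpoly : ∀ l : ℝ, 0 ≤ l →
        ∑ i ∈ Finset.range (n + 1), (n.choose i : ℝ) * l ^ i * W i =
        ∑ i ∈ Finset.range (n + 1), (n.choose i : ℝ) * l ^ i * (α ^ (n - i) * V₁) := by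
      intro l hl
      rw [← hW l hl, hK, ← hK₁conv.add_smul hα.le hl, hvol _ (by linarith), add_comm α l, add_pow,
        Finset.sum_mul]
      refine Finset.sum_congr rfl fun i _ => ?_
      ring
    have h0 : W 0 = α ^ (n - 0) * V₁ := by rw [hW0, hV, Nat.sub_zero]
    have hW1 : W 1 = α ^ (n - 1) * V₁ := le_antisymm
      (poly_cmp (n := n) (by omega) W (fun i => α ^ (n - i) * V₁) h0 fun l hl => (hpoly l hl).le)
      (poly_cmp (n := n) (by omega) (fun i => α ^ (n - i) * V₁) W h0.symm
        fun l hl => (hpoly l hl).ge)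
    rw [hW1, hV]
    obtain ⟨m, rfl⟩ : ∃ m, n = m + 1 := ⟨n - 1, by omega⟩
    simp only [Nat.add_sub_cancel, mul_pow, ← pow_mul]
    ring
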